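/- Let S be an AG-groupoid with a zero element 0 (0·s = s·0 = 0 for all s ∈ S), let Ω be the set of all strongly irreducible proper bi-ideals of S, and for each bi-ideal B of S let O_B = {J ∈ Ω : B ⊄ J}. Then the collection Γ(Ω) = {O_B : B a bi-ideal of S} is the collection of open sets of a topology on Ω; that is, there exists a topology on Ω whose open sets are exactly the sets O_B for B a bi-ideal of S. -/

import Mathlib

open Pointwise

/-- A bi-ideal of an AG-groupoid `S` is a subset `B` with `B·B ⊆ B` and
`(B·S)·B ⊆ B`. -/
def IsBiIdeal {S : Type*} [Mul S] (B : Set S) : Prop :=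
  B * B ⊆ B ∧ (B * (Set.univ : Set S)) * B ⊆ B

/-- A bi-ideal `P` is strongly irreducible if `B₁ ∩ B₂ ⊆ P` implies `B₁ ⊆ P` or
`B₂ ⊆ P` for all bi-ideals `B₁`, `B₂`. -/
def IsStronglyIrreducible {S : Type*} [Mul S] (P : Set S) : Prop :=
  ∀ B₁ B₂ : Set S, IsBiIdeal B₁ → IsBiIdeal B₂ → B₁ ∩ B₂ ⊆ P → B₁ ⊆ P ∨ B₂ ⊆ P

/-- `Ω`: the set of strongly irreducible proper bi-ideals, as a type. -/
def Omega (S : Type*) [Mul S] : Type _ :=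
  {J : Set S // IsBiIdeal J ∧ IsStronglyIrreducible J ∧ J ≠ Set.univ}

theorem isBiIdeal_univ {S : Type*} [Mul S] : IsBiIdeal (Set.univ : Set S) :=
  ⟨Set.subset_univ _, Set.subset_univ _⟩

theorem IsBiIdeal.sInter {S : Type*} [Mul S] {C : Set (Set S)}
    (hC : ∀ B ∈ C, IsBiIdeal B) : IsBiIdeal (⋂₀ C) := by
  refine ⟨Set.subset_sInter fun B hB => ?_, Set.subset_sInter fun B hB => ?_⟩
  · have h := Set.sInter_subset_of_mem hB
    exact (Set.mul_subset_mul h h).trans (hC B hB).1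
  · have h := Set.sInter_subset_of_mem hB
    exact (Set.mul_subset_mul (Set.mul_subset_mul h subset_rfl) h).trans (hC B hB).2

theorem IsBiIdeal.inter {S : Type*} [Mul S] {A B : Set S}
    (hA : IsBiIdeal A) (hB : IsBiIdeal B) : IsBiIdeal (A ∩ B) := by
  rw [← Set.sInter_pair]
  apply IsBiIdeal.sInter
  rintro C (rfl | rfl)
  · exact hA
  · exact hB

/-- The bi-ideal generated by a set. -/
def biIdealClosure {S : Type*} [Mul S] (X : Set S) : Set S :=
  ⋂₀ {B | IsBiIdeal B ∧ X ⊆ B}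

theorem isBiIdeal_biIdealClosure {S : Type*} [Mul S] (X : Set S) :
    IsBiIdeal (biIdealClosure X) :=
  IsBiIdeal.sInter fun _ hB => hB.1

theorem biIdealClosure_subset_iff {S : Type*} [Mul S] {X J : Set S} (hJ : IsBiIdeal J) :
    biIdealClosure X ⊆ J ↔ X ⊆ J :=
  ⟨fun h => (Set.subset_sInter fun _ hB => hB.2).trans h,
    fun h => Set.sInter_subset_of_mem ⟨hJ, h⟩⟩

/-- Let `S` be an AG-groupoid with zero element `z`, let `Ω` be the set of strongly
irreducible proper bi-ideals of `S`, and for each bi-ideal `B` let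
`O_B = {J ∈ Ω : B ⊄ J}`. Then `Γ(Ω) = {O_B : B a bi-ideal}` is the collection of
open sets of a topology on `Ω`. -/
theorem bi_ideal_topology {S : Type*} [Mul S]
    (hinv : ∀ a b c : S, (a * b) * c = (c * b) * a)
    (z : S) (hz : ∀ s : S, z * s = z ∧ s * z = z) :
    ∃ T : TopologicalSpace (Omega S),
      ∀ U : Set (Omega S),
        T.IsOpen U ↔ ∃ B : Set S, IsBiIdeal B ∧ U = {J : Omega S | ¬ B ⊆ J.1} := by
  refine ⟨{ IsOpen := fun U => ∃ B : Set S, IsBiIdeal B ∧ U = {J : Omega S | ¬ B ⊆ J.1}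
            isOpen_univ := ?_
            isOpen_inter := ?_
            isOpen_sUnion := ?_ }, fun U => Iff.rfl⟩
  · refine ⟨Set.univ, isBiIdeal_univ, (Set.eq_univ_of_forall fun J h => ?_).symm⟩
    exact J.2.2.2 (Set.univ_subset_iff.mp h)
  · rintro _ _ ⟨A, hA, rfl⟩ ⟨B, hB, rfl⟩
    refine ⟨A ∩ B, hA.inter hB,
      Set.ext fun J => ⟨fun h hAB => ?_, fun h => ⟨fun hAJ => ?_, fun hBJ => ?_⟩⟩⟩
    · exact (J.2.2.1 A B hA hB hAB).elim h.1 h.2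
    · exact h (Set.inter_subset_left.trans hAJ)
    · exact h (Set.inter_subset_right.trans hBJ)
  · intro F hF
    choose! b hb hU using hF
    refine ⟨biIdealClosure (⋃ U ∈ F, b U), isBiIdeal_biIdealClosure _, Set.ext fun J => ?_⟩
    have hmem : ∀ U ∈ F, (J ∈ U ↔ ¬ b U ⊆ J.1) := fun U h =>
      Iff.of_eq (congrArg (J ∈ ·) (hU U h))
    rw [Set.mem_ofPred_eq, biIdealClosure_subset_iff J.2.1, Set.iUnion₂_subset_iff]
    push Not
    exact exists_congr fun U => ⟨fun h => ⟨h.1, (hmem U h.1).1 h.2⟩,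
      fun ⟨h₁, h₂⟩ => ⟨h₁, (hmem U h₁).2 h₂⟩⟩
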